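/- Under the stated hypotheses (Mostow tangent decomposition of A at Z = W·P₁·P₂), assume moreover that ‖Y₂‖ ≤ β(Z)·cond(Z)·(1 + cond(Z)⁴)·‖A‖. Then ‖Q·(iY₁)·Q‖ ≤ ‖P₁‖·‖P₁^{-1}‖·‖P₂^{-1}‖·(1 + ‖P₁‖·β(Z)·cond(Z)·(1 + cond(Z)⁴))·‖A‖. -/

import Mathlib

open Matrix MeasureTheory Real
open scoped Matrix.Norms.L2Operator ComplexOrder

-- `psqrt M` is the unique positive semidefinite square root of a positive semidefinite matrix
open Classical in
noncomputable def psqrt {n : ℕ} (M : Matrix (Fin n) (Fin n) ℂ) : Matrix (Fin n) (Fin n) ℂ :=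
  if h : M.PosSemidef then
    (h.1.eigenvectorUnitary : Matrix (Fin n) (Fin n) ℂ) *
      Matrix.diagonal ((fun x : ℝ => (x : ℂ)) ∘ Real.sqrt ∘ h.1.eigenvalues) *
      (star h.1.eigenvectorUnitary : Matrix (Fin n) (Fin n) ℂ)
  else 0

-- the geometric mean  A#B = A^{1/2} (A^{-1/2} B A^{-1/2})^{1/2} A^{1/2}
noncomputable def gm {n : ℕ} (A B : Matrix (Fin n) (Fin n) ℂ) : Matrix (Fin n) (Fin n) ℂ :=
  psqrt A * psqrt ((psqrt A)⁻¹ * B * (psqrt A)⁻¹) * psqrt A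

-- entrywise complex conjugate
def mconj {n : ℕ} (M : Matrix (Fin n) (Fin n) ℂ) : Matrix (Fin n) (Fin n) ℂ := Mᴴᵀ

-- smallest eigenvalue of a Hermitian matrix
noncomputable def lmin {n : ℕ} {C : Matrix (Fin n) (Fin n) ℂ} (hC : C.IsHermitian) : ℝ :=
  ⨅ i, hC.eigenvalues i

-- ρ₂(Z) = (Z*Z # conj(Z*Z))^{1/2}
noncomputable def rho2 {n : ℕ} (Z : Matrix (Fin n) (Fin n) ℂ) : Matrix (Fin n) (Fin n) ℂ :=
  psqrt (gm (Zᴴ * Z) (mconj (Zᴴ * Z)))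

-- C_Z = (Z*Z)⁻¹ (Z*Z # conj(Z*Z))
noncomputable def CZ {n : ℕ} (Z : Matrix (Fin n) (Fin n) ℂ) : Matrix (Fin n) (Fin n) ℂ :=
  (Zᴴ * Z)⁻¹ * gm (Zᴴ * Z) (mconj (Zᴴ * Z))

-- β(Z) = ∫₀^∞ ‖exp(-t C_Z)‖² dt
noncomputable def beta {n : ℕ} (Z : Matrix (Fin n) (Fin n) ℂ) : ℝ :=
  ∫ t in Set.Ioi (0 : ℝ), ‖NormedSpace.exp ((-t) • CZ Z)‖ ^ 2

-- cond(Z) = ‖Z‖ ‖Z⁻¹‖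
noncomputable def condNum {n : ℕ} (Z : Matrix (Fin n) (Fin n) ℂ) : ℝ := ‖Z‖ * ‖Z⁻¹‖

theorem aux_clm {E : Type*} [NormedAddCommGroup E] [InnerProductSpace ℂ E] [CompleteSpace E]
    (B X H S P Q R : E →L[ℂ] E) (hX : star X = -X) (hH : star H = H) (hR : star R = R)
    (hB : B * S = X + H * S) (hS : S = R * R) (hQR : Q * R = 1) (hQ : ‖Q‖ * ‖Q‖ = ‖P‖)
    (l : ℝ) (v : E) (hv : v ≠ 0) (hl : H v = (l : ℂ) • v) :
    |l| ≤ ‖P‖ * ‖S‖ * ‖B‖ := by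
  have adj : ∀ (T : E →L[ℂ] E) (x y : E), inner ℂ x (T y) = inner ℂ (star T x) y := by
    intro T x y
    rw [ContinuousLinearMap.star_eq_adjoint, ContinuousLinearMap.adjoint_inner_left]
  have hXv : (inner ℂ v (X v)).re = 0 := by
    have h1 := adj X v v
    rw [hX, _root_.neg_apply, inner_neg_left, ← inner_conj_symm] at h1
    have h2 := congrArg Complex.re h1
    rw [← inner_conj_symm] at h2
    simp only [Complex.neg_re, Complex.conj_re] at h2
    have h3 : (inner ℂ (X v) v).re = (inner ℂ v (X v)).re := by
      rw [← inner_conj_symm, Complex.conj_re]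
    linarith
  have hSv : inner ℂ v (S v) = ((‖R v‖ ^ 2 : ℝ) : ℂ) := by
    rw [hS, mul_apply_eq_comp, adj, hR, inner_self_eq_norm_sq_to_K]
    simp
  have hkey : (inner ℂ v (B (S v))).re = l * ‖R v‖ ^ 2 := by
    have : B (S v) = X v + H (S v) := by
      have := congrArg (fun T : E →L[ℂ] E => T v) hB
      simpa using this
    rw [this, inner_add_right, Complex.add_re, hXv, adj H, hH, hl, inner_smul_left, hSv,
      Complex.conj_ofReal, ← Complex.ofReal_mul, Complex.ofReal_re, zero_add]
  have h1 : |l| * ‖R v‖ ^ 2 ≤ ‖v‖ * (‖B‖ * (‖S‖ * ‖v‖)) := by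
    calc |l| * ‖R v‖ ^ 2 = |(inner ℂ v (B (S v))).re| := by
          rw [hkey, abs_mul, abs_of_nonneg (sq_nonneg ‖R v‖)]
      _ ≤ ‖inner ℂ v (B (S v))‖ := Complex.abs_re_le_norm _
      _ ≤ ‖v‖ * ‖B (S v)‖ := norm_inner_le_norm _ _
      _ ≤ ‖v‖ * (‖B‖ * (‖S‖ * ‖v‖)) := by
          gcongr
          exact (B.le_opNorm _).trans (by gcongr; exact S.le_opNorm _)
  have hvR : ‖v‖ ≤ ‖Q‖ * ‖R v‖ := by
    have : v = Q (R v) := by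
      have := congrArg (fun T : E →L[ℂ] E => T v) hQR
      simpa using this.symm
    calc ‖v‖ = ‖Q (R v)‖ := by rw [← this]
      _ ≤ _ := Q.le_opNorm _
  have hpos : 0 < ‖R v‖ := by
    have hv' : 0 < ‖v‖ := norm_pos_iff.mpr hv
    by_contra h
    have : ‖R v‖ = 0 := le_antisymm (not_lt.mp h) (norm_nonneg _)
    rw [this, mul_zero] at hvR
    linarith
  have h2 : |l| * ‖R v‖ ^ 2 ≤ (‖P‖ * ‖S‖ * ‖B‖) * ‖R v‖ ^ 2 := by
    calc _ ≤ _ := h1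
      _ ≤ (‖Q‖ * ‖R v‖) * (‖B‖ * (‖S‖ * (‖Q‖ * ‖R v‖))) := by gcongr
      _ = (‖Q‖ * ‖Q‖ * ‖S‖ * ‖B‖) * ‖R v‖ ^ 2 := by ring
      _ = _ := by rw [hQ]
  exact le_of_mul_le_mul_right h2 (by positivity)

theorem aux_norm {n : ℕ} (H : Matrix (Fin n) (Fin n) ℂ) (hH : H.IsHermitian) (c : ℝ) (hc : 0 ≤ c)
    (h : ∀ i, |hH.eigenvalues i| ≤ c) : ‖H‖ ≤ c := by
  have hs := hH.spectral_theorem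
  rw [Unitary.conjStarAlgAut_apply] at hs
  rw [hs]
  rw [← Unitary.coe_star, CStarRing.norm_mul_coe_unitary, CStarRing.norm_coe_unitary_mul,
    Matrix.l2_opNorm_diagonal]
  refine (pi_norm_le_iff_of_nonneg hc).mpr fun i => ?_
  simpa using h i

theorem aux_mat {n : ℕ} (B X H P Q : Matrix (Fin n) (Fin n) ℂ) (hX : Xᴴ = -X)
    (hH : H.IsHermitian) (hQ : Q.PosDef) (hP : Q * Q = P) (hB : B = X * P + H) :
    ‖H‖ ≤ ‖P‖ * ‖P⁻¹‖ * ‖B‖ := by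
  refine aux_norm H hH _ (by positivity) fun i => ?_
  have hQu : IsUnit Q.det := (Matrix.isUnit_iff_isUnit_det Q).mp hQ.isUnit
  have hPu : IsUnit P.det := by rw [← hP, det_mul]; exact hQu.mul hQu
  let e := Matrix.toEuclideanCLM (n := Fin n) (𝕜 := ℂ)
  refine aux_clm (e B) (e X) (e H) (e P⁻¹) (e P) (e Q) (e Q⁻¹) ?_ ?_ ?_ ?_ ?_ ?_ ?_
    (hH.eigenvalues i) (hH.eigenvectorBasis i) ?_ ?_
  · rw [← map_star, star_eq_conjTranspose, hX, map_neg]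
  · rw [← map_star, star_eq_conjTranspose, hH.eq]
  · rw [← map_star, star_eq_conjTranspose, hQ.isHermitian.inv.eq]
  · rw [← map_mul, ← map_mul, ← map_add, hB, add_mul, mul_assoc, Matrix.mul_nonsing_inv _ hPu,
      mul_one]
  · rw [← map_mul, ← hP, Matrix.mul_inv_rev]
  · rw [← map_mul, Matrix.mul_nonsing_inv _ hQu, map_one]
  · rw [← hP]
    have : ‖star Q * Q‖ = ‖Q‖ * ‖Q‖ := CStarRing.norm_star_mul_self
    rw [star_eq_conjTranspose, hQ.isHermitian.eq] at this
    exact this.symm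
  · exact hH.eigenvectorBasis.orthonormal.ne_zero i
  · have := hH.mulVec_eigenvectorBasis i
    apply (WithLp.ofLp_injective 2)
    simpa [e] using this

/-- bound on the `P₁`-component of the Mostow tangent decomposition. -/
theorem stmt12 {n : ℕ} (hn : 0 < n)
    (W P₁ Q P₂ X Y₁ Y₂ A : Matrix (Fin n) (Fin n) ℂ)
    (hW : W ∈ Matrix.unitaryGroup (Fin n) ℂ)
    (hP₁ : P₁.PosDef) (hcirc : mconj P₁ * P₁ = 1)
    (hQ : Q.PosDef) (hQ2 : Q * Q = P₁)
    (hP₂ : P₂.PosDef) (hP₂r : ∀ i j, (P₂ i j).im = 0)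
    (hX : Xᴴ = -X)
    (hY₁r : ∀ i j, (Y₁ i j).im = 0) (hY₁ : Y₁ᵀ = -Y₁)
    (hY₂r : ∀ i j, (Y₂ i j).im = 0) (hY₂ : Y₂ᵀ = Y₂)
    (hA : A = W * X * P₁ * P₂ + W * Q * (Complex.I • Y₁) * Q * P₂ + W * P₁ * Y₂)
    (Z : Matrix (Fin n) (Fin n) ℂ) (hZ : Z = W * P₁ * P₂)
    (hY₂bd : ‖Y₂‖ ≤ beta Z * condNum Z * (1 + condNum Z ^ 4) * ‖A‖) :
    ‖Q * (Complex.I • Y₁) * Q‖ ≤ ‖P₁‖ * ‖P₁⁻¹‖ * ‖P₂⁻¹‖ *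
      (1 + ‖P₁‖ * beta Z * condNum Z * (1 + condNum Z ^ 4)) * ‖A‖ := by
  set H := Q * (Complex.I • Y₁) * Q with hHdef
  have hQu : IsUnit Q.det := (Matrix.isUnit_iff_isUnit_det Q).mp hQ.isUnit
  have hP₂u : IsUnit P₂.det := (Matrix.isUnit_iff_isUnit_det P₂).mp hP₂.isUnit
  have hY₁H : Y₁ᴴ = -Y₁ := by
    rw [← hY₁]
    ext i j
    simp only [conjTranspose_apply, transpose_apply]
    exact Complex.conj_eq_iff_im.mpr (hY₁r j i)
  have hH : H.IsHermitian := by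
    unfold Matrix.IsHermitian
    rw [hHdef, conjTranspose_mul, conjTranspose_mul, conjTranspose_smul, hY₁H,
      hQ.isHermitian.eq, mul_assoc]
    simp
  have hWW : star W * W = 1 := (Matrix.mem_unitaryGroup_iff').mp hW
  haveI : Nonempty (Fin n) := ⟨⟨0, hn⟩⟩
  have hWn : ‖star W‖ ≤ 1 := (CStarRing.norm_of_mem_unitary (Unitary.star_mem hW)).le
  have hB : (star W * A - P₁ * Y₂) * P₂⁻¹ = X * P₁ + H := by
    have : star W * A - P₁ * Y₂ = (X * P₁ + H) * P₂ := by
      have e : A = W * ((X * P₁ + H) * P₂ + P₁ * Y₂) := by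
        rw [hA, hHdef]; noncomm_ring
      rw [e, ← mul_assoc, hWW, one_mul, add_sub_cancel_right]
    rw [this, mul_assoc, Matrix.mul_nonsing_inv _ hP₂u, mul_one]
  have h1 := aux_mat _ X H P₁ Q hX hH hQ hQ2 hB
  set b := beta Z * condNum Z * (1 + condNum Z ^ 4) with hb
  have h2 : ‖(star W * A - P₁ * Y₂) * P₂⁻¹‖ ≤ (1 * ‖A‖ + ‖P₁‖ * (b * ‖A‖)) * ‖P₂⁻¹‖ := by
    refine (norm_mul_le _ _).trans ?_
    gcongr
    refine (norm_sub_le _ _).trans (add_le_add ?_ ?_)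
    · exact (norm_mul_le _ _).trans (by gcongr)
    · exact (norm_mul_le _ _).trans (by gcongr)
  calc ‖H‖ ≤ _ := h1
    _ ≤ ‖P₁‖ * ‖P₁⁻¹‖ * ((1 * ‖A‖ + ‖P₁‖ * (b * ‖A‖)) * ‖P₂⁻¹‖) := by gcongr
    _ = _ := by rw [hb]; ring
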